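/- arXiv:1509.03815 — 6 statements merged into one kernel-verified Lean document; each statement's English description precedes it below -/
import Mathlib

section
/- Let D ≥ 𝒟. Every terminal configuration of Algo_U, every terminal configuration of Algo_B(D), and every terminal configuration of Algo_HC(D) is legitimate. -/
open SimpleGraph

structure Config (V : Type*) where
  d : V → ℕ
  par : V → V

/-- `Min_d(p)`: the minimum of the `d`-values of the neighbors of `p`. -/
noncomputable def minD {V : Type*} (G : SimpleGraph V) (γ : Config V) (p : V) : ℕ :=
  sInf (γ.d '' {q | G.Adj p q})

def dOk {V : Type*} (G : SimpleGraph V) (γ : Config V) (p : V) : Prop :=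
  γ.d p = minD G γ p + 1

def parOk {V : Type*} (γ : Config V) (p : V) : Prop :=
  γ.d p = γ.d (γ.par p) + 1

/-- A valid configuration of `Algo_U`. -/
def ValidU {V : Type*} (G : SimpleGraph V) (r : V) (γ : Config V) : Prop :=
  γ.d r = 0 ∧ ∀ p, p ≠ r → G.Adj p (γ.par p)

/-- A valid configuration of `Algo_B(D)` / `Algo_HC(D)`: non-root `d`-values lie in `{1,…,D}`. -/
def ValidB {V : Type*} (G : SimpleGraph V) (r : V) (D : ℕ) (γ : Config V) : Prop :=
  γ.d r = 0 ∧ ∀ p, p ≠ r → G.Adj p (γ.par p) ∧ 1 ≤ γ.d p ∧ γ.d p ≤ D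

def Legitimate {V : Type*} (G : SimpleGraph V) (r : V) (γ : Config V) : Prop :=
  (∀ p, γ.d p = G.dist p r) ∧ ∀ p, p ≠ r → γ.d p = γ.d (γ.par p) + 1

/-- Terminal configurations of `Algo_U`. -/
def TerminalU {V : Type*} (G : SimpleGraph V) (r : V) (γ : Config V) : Prop :=
  ∀ p, p ≠ r → dOk G γ p ∧ parOk γ p

/-- Terminal configurations of `Algo_B(D)`. -/
def TerminalB {V : Type*} (G : SimpleGraph V) (r : V) (D : ℕ) (γ : Config V) : Prop :=
  ∀ p, p ≠ r →
    (minD G γ p < D → dOk G γ p ∧ parOk γ p) ∧ (minD G γ p = D → γ.d p = D)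

/-- Terminal configurations of `Algo_HC(D)`. -/
def TerminalHC {V : Type*} (G : SimpleGraph V) (r : V) (D : ℕ) (γ : Config V) : Prop :=
  ∀ p, p ≠ r →
    (parOk γ p ∨ D ≤ γ.d (γ.par p)) ∧ γ.d (γ.par p) ≤ minD G γ p

theorem minD_le_of_adj {V : Type*} {G : SimpleGraph V} (γ : Config V) {p q : V}
    (hpq : G.Adj p q) : minD G γ p ≤ γ.d q :=
  Nat.sInf_le ⟨q, hpq, rfl⟩

theorem exists_adj_dist_add_one_eq {V : Type*} {G : SimpleGraph V} (hconn : G.Connected)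
    {p r : V} (hpr : p ≠ r) : ∃ q, G.Adj p q ∧ G.dist q r + 1 = G.dist p r := by
  obtain ⟨w, hw⟩ := hconn.exists_walk_length_eq_dist p r
  cases w with
  | nil => exact absurd rfl hpr
  | @cons _ q _ hpq w =>
    refine ⟨q, hpq, ?_⟩
    have hq := dist_le w
    have htri := hconn.dist_triangle (u := p) (v := q) (w := r)
    rw [dist_eq_one_iff_adj.mpr hpq] at htri
    rw [Walk.length_cons] at hw
    omega

/-- A configuration is legitimate as soon as every non-root vertex that has a neighbor of small
enough value is one above its parent, and its parent is at most that neighbor. -/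
theorem legitimate_of_forall_adj {V : Type*} {G : SimpleGraph V} (hconn : G.Connected)
    {r : V} {γ : Config V} (hr : γ.d r = 0) (hpar : ∀ p, p ≠ r → G.Adj p (γ.par p))
    (hstep : ∀ p, p ≠ r → ∀ q, G.Adj p q → γ.d q < G.dist p r →
      parOk γ p ∧ γ.d (γ.par p) ≤ γ.d q) :
    Legitimate G r γ := by
  have hle : ∀ n p, G.dist p r = n → γ.d p ≤ n := by
    intro n
    induction n with
    | zero =>
      intro p hp
      rw [hconn.dist_eq_zero_iff.mp hp, hr]
    | succ n ih =>
      intro p hp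
      have hpr : p ≠ r := by
        rintro rfl
        simp at hp
      obtain ⟨q, hpq, hq⟩ := exists_adj_dist_add_one_eq hconn hpr
      have hdq := ih q (by omega)
      obtain ⟨hok, hmin⟩ := hstep p hpr q hpq (by omega)
      unfold parOk at hok
      omega
  have hok : ∀ p, p ≠ r → γ.d p = γ.d (γ.par p) + 1 := by
    intro p hpr
    obtain ⟨q, hpq, hq⟩ := exists_adj_dist_add_one_eq hconn hpr
    have hdq := hle _ q rfl
    exact (hstep p hpr q hpq (by omega)).1
  have hge : ∀ n p, γ.d p = n → G.dist p r ≤ n := by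
    intro n
    induction n with
    | zero =>
      intro p hp
      by_cases hpr : p = r
      · simp [hpr]
      · have := hok p hpr
        omega
    | succ n ih =>
      intro p hp
      by_cases hpr : p = r
      · simp [hpr]
      · have hpd := hok p hpr
        have hpar_dist := ih (γ.par p) (by omega)
        have htri := hconn.dist_triangle (u := p) (v := γ.par p) (w := r)
        rw [dist_eq_one_iff_adj.mpr (hpar p hpr)] at htri
        omega
  exact ⟨fun p => le_antisymm (hle _ p rfl) (hge _ p rfl), hok⟩

/-- Let `D ≥ 𝒟`. Every terminal configuration of `Algo_U`, of `Algo_B(D)` and of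
`Algo_HC(D)` is legitimate. -/
theorem terminal_is_legitimate {V : Type*} [Fintype V]
    (G : SimpleGraph V) (hconn : G.Connected) (hcard : 2 ≤ Fintype.card V)
    (r : V) (D : ℕ) (hD : G.diam ≤ D) :
    (∀ γ : Config V, ValidU G r γ → TerminalU G r γ → Legitimate G r γ) ∧
    (∀ γ : Config V, ValidB G r D γ → TerminalB G r D γ → Legitimate G r γ) ∧
    (∀ γ : Config V, ValidB G r D γ → TerminalHC G r D γ → Legitimate G r γ) := by
  have : Nonempty V := ⟨r⟩
  have hdist : ∀ p, G.dist p r ≤ D := fun p =>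
    (dist_le_diam (connected_iff_ediam_ne_top.mp hconn)).trans hD
  refine ⟨fun γ hv ht => ?_, fun γ hv ht => ?_, fun γ hv ht => ?_⟩
  · refine legitimate_of_forall_adj hconn hv.1 hv.2 fun p hpr q hpq _ => ?_
    obtain ⟨hd, hp⟩ := ht p hpr
    have hmin := minD_le_of_adj γ hpq
    refine ⟨hp, ?_⟩
    unfold dOk at hd
    unfold parOk at hp
    omega
  · refine legitimate_of_forall_adj hconn hv.1 (fun p hpr => (hv.2 p hpr).1)
      fun p hpr q hpq hq => ?_
    have hmin := minD_le_of_adj γ hpq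
    obtain ⟨hd, hp⟩ := (ht p hpr).1 (hmin.trans_lt (hq.trans_le (hdist p)))
    refine ⟨hp, ?_⟩
    unfold dOk at hd
    unfold parOk at hp
    omega
  · refine legitimate_of_forall_adj hconn hv.1 (fun p hpr => (hv.2 p hpr).1)
      fun p hpr q hpq hq => ?_
    have hpar := (ht p hpr).2.trans (minD_le_of_adj γ hpq)
    refine ⟨(ht p hpr).1.resolve_right ?_, hpar⟩
    have := hdist p
    omega
end

section
/- Under a distributed unfair daemon, every execution of Algo_U is finite: there is no infinite sequence of configurations γ_0, γ_1, γ_2, … such that γ_i ↦ γ_{i+1} is a step of Algo_U for all i. -/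
open SimpleGraph

/-- Vertex `p` executes rule `U1` or `U2` in the step from `γ` to `γ'`:
`U1 : ¬dOk(p) → update(p)`, `U2 : dOk(p) ∧ ¬parOk(p) → par_p ← bestParent(p)`. -/
def execU {V : Type*} (G : SimpleGraph V) (γ γ' : Config V) (p : V) : Prop :=
  (¬ dOk G γ p ∧ γ'.d p = minD G γ p + 1 ∧
    G.Adj p (γ'.par p) ∧ γ.d (γ'.par p) = minD G γ p) ∨
  (dOk G γ p ∧ ¬ parOk γ p ∧ γ'.d p = γ.d p ∧
    G.Adj p (γ'.par p) ∧ γ.d (γ'.par p) = minD G γ p)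

/-- Vertex `p` executes one of the rules `B1`, `B2`, `B3` of `Algo_B(D)`. -/
def execB {V : Type*} (G : SimpleGraph V) (D : ℕ) (γ γ' : Config V) (p : V) : Prop :=
  (minD G γ p < D ∧ ¬ dOk G γ p ∧ γ'.d p = minD G γ p + 1 ∧
    G.Adj p (γ'.par p) ∧ γ.d (γ'.par p) = minD G γ p) ∨
  (minD G γ p < D ∧ dOk G γ p ∧ ¬ parOk γ p ∧ γ'.d p = γ.d p ∧
    G.Adj p (γ'.par p) ∧ γ.d (γ'.par p) = minD G γ p) ∨
  (minD G γ p = D ∧ γ.d p ≠ D ∧ γ'.d p = D ∧ γ'.par p = γ.par p)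

/-- Vertex `p` executes rule `HC1` or `HC2` of `Algo_HC(D)`. -/
def execHC {V : Type*} (G : SimpleGraph V) (D : ℕ) (γ γ' : Config V) (p : V) : Prop :=
  (¬ parOk γ p ∧ γ.d (γ.par p) < D ∧ γ'.d p = γ.d (γ.par p) + 1 ∧ γ'.par p = γ.par p) ∨
  (minD G γ p < γ.d (γ.par p) ∧ γ'.d p = minD G γ p + 1 ∧
    G.Adj p (γ'.par p) ∧ γ.d (γ'.par p) = minD G γ p)

/-- Vertex `p` executes rule `HC2`: `d_{par_p} > Min_d(p) → update(p)`. -/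
def execHC2 {V : Type*} (G : SimpleGraph V) (γ γ' : Config V) (p : V) : Prop :=
  minD G γ p < γ.d (γ.par p) ∧ γ'.d p = minD G γ p + 1 ∧
    G.Adj p (γ'.par p) ∧ γ.d (γ'.par p) = minD G γ p

/-- Vertex `p` executes rule `FHC1` or `HC2` of `Algo_FHC(D)`. -/
def execFHC {V : Type*} (G : SimpleGraph V) (D : ℕ) (γ γ' : Config V) (p : V) : Prop :=
  (¬ parOk γ p ∧ γ.d (γ.par p) < D ∧ γ.d (γ.par p) = minD G γ p ∧
    γ'.d p = γ.d (γ.par p) + 1 ∧ γ'.par p = γ.par p) ∨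
  execHC2 G γ γ' p

/-- A step of a distributed unfair daemon: a nonempty set `S` of (non-root) vertices,
each executing one of its enabled rules (as described by `exec`), all other vertices
keeping their state. -/
def StepWith {V : Type*} (r : V) (exec : Config V → Config V → V → Prop)
    (γ γ' : Config V) (S : Set V) : Prop :=
  S.Nonempty ∧ (∀ p ∈ S, p ≠ r ∧ exec γ γ' p) ∧
    ∀ p ∉ S, γ'.d p = γ.d p ∧ γ'.par p = γ.par p

def Step {V : Type*} (r : V) (exec : Config V → Config V → V → Prop)
    (γ γ' : Config V) : Prop :=
  ∃ S : Set V, StepWith r exec γ γ' S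

/-- Guard of the rules of `Algo_U` at `p`. -/
def guardU {V : Type*} (G : SimpleGraph V) (γ : Config V) (p : V) : Prop :=
  ¬ dOk G γ p ∨ (dOk G γ p ∧ ¬ parOk γ p)

/-- Guard of the rules of `Algo_B(D)` at `p`. -/
def guardB {V : Type*} (G : SimpleGraph V) (D : ℕ) (γ : Config V) (p : V) : Prop :=
  (minD G γ p < D ∧ ¬ dOk G γ p) ∨
  (minD G γ p < D ∧ dOk G γ p ∧ ¬ parOk γ p) ∨
  (minD G γ p = D ∧ γ.d p ≠ D)

/-- Guard of the rules of `Algo_HC(D)` at `p`. -/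
def guardHC {V : Type*} (G : SimpleGraph V) (D : ℕ) (γ : Config V) (p : V) : Prop :=
  (¬ parOk γ p ∧ γ.d (γ.par p) < D) ∨ minD G γ p < γ.d (γ.par p)

/-- Guard of the rules of `Algo_FHC(D)` at `p`. -/
def guardFHC {V : Type*} (G : SimpleGraph V) (D : ℕ) (γ : Config V) (p : V) : Prop :=
  (¬ parOk γ p ∧ γ.d (γ.par p) < D ∧ γ.d (γ.par p) = minD G γ p) ∨
  minD G γ p < γ.d (γ.par p)

/-- A vertex is enabled when it is not the root and one of its guards holds. -/
def Enabled {V : Type*} (r : V) (guard : Config V → V → Prop) (γ : Config V) (p : V) : Prop :=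
  p ≠ r ∧ guard γ p

/-- A terminal configuration: no vertex is enabled. -/
def Terminal {V : Type*} (r : V) (guard : Config V → V → Prop) (γ : Config V) : Prop :=
  ∀ p, ¬ Enabled r guard γ p

/-- An execution (padded by stuttering once a terminal configuration is reached, so
that maximality is automatic): `e i` is the `i`-th configuration and `M i` the set of
vertices selected by the daemon at step `i`. -/
def IsExec {V : Type*} (r : V) (valid : Config V → Prop)
    (exec : Config V → Config V → V → Prop) (guard : Config V → V → Prop)
    (e : ℕ → Config V) (M : ℕ → Set V) : Prop :=
  (∀ i, valid (e i)) ∧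
    ∀ i, (Terminal r guard (e i) ∧ e (i + 1) = e i ∧ M i = ∅) ∨
      StepWith r exec (e i) (e (i + 1)) (M i)

/-- Every vertex enabled in `e s` executes a rule or becomes neutralized in some step
`j` with `s ≤ j < t`. -/
def Covers {V : Type*} (r : V) (guard : Config V → V → Prop)
    (e : ℕ → Config V) (M : ℕ → Set V) (s t : ℕ) : Prop :=
  ∀ p, Enabled r guard (e s) p →
    ∃ j, s ≤ j ∧ j < t ∧
      (p ∈ M j ∨ (Enabled r guard (e j) p ∧ ¬ Enabled r guard (e (j + 1)) p))

/-- `t` is the end of the round of execution `(e, M)` starting at index `s`: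
the prefix from `s` to `t` is the minimal one in which every vertex enabled at `e s`
executes a rule or is neutralized. -/
def RoundEnd {V : Type*} (r : V) (guard : Config V → V → Prop)
    (e : ℕ → Config V) (M : ℕ → Set V) (s t : ℕ) : Prop :=
  s ≤ t ∧ Covers r guard e M s t ∧ ∀ u, s ≤ u → Covers r guard e M s u → t ≤ u

open Filter in
/-- If every change of `f · p` sets it to one more than the minimum over the neighbors of `p`,
then each vertex changes to each given value only finitely often. -/
theorem eventually_not_change_to {V : Type*} [Finite V] (G : SimpleGraph V) (f : ℕ → V → ℕ)
    (hle : ∀ i p, f (i + 1) p ≠ f i p → ∀ q, G.Adj p q → f (i + 1) p ≤ f i q + 1)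
    (hex : ∀ i p, f (i + 1) p ≠ f i p → ∃ q, G.Adj p q ∧ f (i + 1) p = f i q + 1)
    (v : ℕ) : ∀ p, ∀ᶠ i in atTop, ¬ (f (i + 1) p ≠ f i p ∧ f (i + 1) p = v) := by
  induction v using Nat.strong_induction_on with
  | _ v ih =>
    intro p
    by_contra hp
    obtain ⟨q, hpq, hq⟩ : ∃ q, G.Adj p q ∧ ∃ᶠ i in atTop, f i q + 1 = v := by
      by_contra! hno
      refine hp ?_
      have hall : ∀ᶠ i in atTop, ∀ q, G.Adj p q → f i q + 1 ≠ v := by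
        refine eventually_all.2 fun q => ?_
        by_cases hpq : G.Adj p q
        · filter_upwards [hno q hpq] with i hi _ using hi
        · exact Eventually.of_forall fun i h => absurd h hpq
      filter_upwards [hall] with i hi ⟨hne, hv⟩
      obtain ⟨q, hpq, hq⟩ := hex i p hne
      exact hi q hpq (hq ▸ hv)
    obtain ⟨u, rfl⟩ : ∃ u, v = u + 1 := by
      obtain ⟨i, hi⟩ := hq.exists
      exact ⟨_, hi.symm⟩
    obtain ⟨N, hN⟩ := eventually_atTop.1 (ih u u.lt_succ_self q)
    have hconst : ∀ i ≥ N, f i q = u := by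
      intro i hi
      by_contra hne
      have hstay : ∀ j ≥ i, f j q ≠ u := by
        intro j hj
        induction j, hj using Nat.le_induction with
        | base => exact hne
        | succ j hj hjq => exact fun h => hN j (hi.trans hj) ⟨fun h' => hjq (h' ▸ h), h⟩
      obtain ⟨j, hj, hju⟩ := frequently_atTop.1 hq i
      exact hstay j hj (by omega)
    have hsmall : ∀ᶠ i in atTop, ∀ w ∈ Set.Iio (u + 1),
        ¬ (f (i + 1) p ≠ f i p ∧ f (i + 1) p = w) :=
      (eventually_all_finite (Set.finite_Iio (u + 1))).2 fun w hw => ih w hw p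
    obtain ⟨M, hM⟩ := eventually_atTop.1 hsmall
    have hset : ∀ i ≥ max M N, f (i + 1) p ≠ f i p → f (i + 1) p = u + 1 := by
      intro i hi hne
      have hub := hle i p hne q hpq
      rw [hconst i (le_of_max_le_right hi)] at hub
      by_contra hv
      exact hM i (le_of_max_le_left hi) _ (Set.mem_Iio.2 (lt_of_le_of_ne hub hv)) ⟨hne, rfl⟩
    obtain ⟨i, hi, -, hiv⟩ := frequently_atTop.1 (not_eventually.1 hp |>.mono
      fun _ h => not_not.1 h) (max M N)
    have hstay : ∀ j ≥ i + 1, f j p = u + 1 := by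
      intro j hj
      induction j, hj using Nat.le_induction with
      | base => exact hiv
      | succ j hj hjp =>
        by_cases hne : f (j + 1) p = f j p
        · exact hne.trans hjp
        · exact hset j (by omega) hne
    obtain ⟨j, hj, hne, -⟩ := frequently_atTop.1 (not_eventually.1 hp |>.mono
      fun _ h => not_not.1 h) (i + 1)
    exact hne ((hstay (j + 1) (by omega)).trans (hstay j hj).symm)

/-- If `f i r = 0` throughout and every change of `f · p` sets it to at most one more than each
neighbor of `p`, then `f i p` exceeds an initial bound by at most the distance from `p` to `r`. -/
theorem le_add_dist_of_change_le {V : Type*} (G : SimpleGraph V) (hconn : G.Connected) (r : V)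
    (f : ℕ → V → ℕ) (hr : ∀ i, f i r = 0)
    (hle : ∀ i p, f (i + 1) p ≠ f i p → ∀ q, G.Adj p q → f (i + 1) p ≤ f i q + 1)
    (B : ℕ) (hB : ∀ p, f 0 p ≤ B) (i : ℕ) : ∀ p, f i p ≤ B + G.dist p r := by
  induction i with
  | zero => exact fun p => (hB p).trans (Nat.le_add_right _ _)
  | succ i ih =>
    intro p
    by_cases hne : f (i + 1) p = f i p
    · exact hne ▸ ih p
    obtain ⟨w, hw⟩ := hconn.exists_walk_length_eq_dist p r
    cases w with
    | nil => simp [hr]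
    | @cons _ q _ h w =>
      have h1 := hle i p hne q h
      have h2 := ih q
      have h3 := SimpleGraph.dist_le w
      rw [SimpleGraph.Walk.length_cons] at hw
      omega

/-- In a step of `Algo_U`, a vertex whose distance value changes takes the value
`minD G γ p + 1`, which is attained at a neighbor. -/
theorem Step.change {V : Type*} {G : SimpleGraph V} {r : V} {γ γ' : Config V}
    (h : Step r (execU G) γ γ') {p : V} (hp : γ'.d p ≠ γ.d p) :
    γ'.d p = minD G γ p + 1 ∧ ∃ q, G.Adj p q ∧ γ.d q = minD G γ p := by
  obtain ⟨S, -, hS, hnS⟩ := h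
  by_cases hpS : p ∈ S
  · rcases (hS p hpS).2 with ⟨-, hd, hadj, hpar⟩ | ⟨-, -, hd, -⟩
    · exact ⟨hd, _, hadj, hpar⟩
    · exact absurd hd hp
  · exact absurd (hnS p hpS).1 hp

/-- In a step of `Algo_U` that changes no distance value, `parOk` is preserved, and some vertex
violating it gets repaired. -/
theorem Step.parOk_of_d_eq {V : Type*} {G : SimpleGraph V} {r : V} {γ γ' : Config V}
    (h : Step r (execU G) γ γ') (hd : γ'.d = γ.d) :
    (∀ p, parOk γ p → parOk γ' p) ∧ ∃ p, ¬ parOk γ p ∧ parOk γ' p := by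
  obtain ⟨S, ⟨s, hs⟩, hS, hnS⟩ := h
  have key : ∀ p ∈ S, ¬ parOk γ p ∧ parOk γ' p := by
    intro p hp
    rcases (hS p hp).2 with ⟨hbad, hd', -⟩ | ⟨hok, hpar, -, -, hmin⟩
    · exact absurd ((congrFun hd p).symm.trans hd') hbad
    · refine ⟨hpar, ?_⟩
      unfold parOk
      rw [hd, hmin]
      exact hok
  refine ⟨fun p hp => ?_, s, key s hs⟩
  have hpS : p ∉ S := fun hpS => (key p hpS).1 hp
  unfold parOk at hp ⊢
  rwa [hd, (hnS p hpS).2]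

/-- Under a distributed unfair daemon, every execution of `Algo_U` is finite: there is
no infinite sequence of configurations `γ_0, γ_1, …` such that `γ_i ↦ γ_{i+1}` is a
step of `Algo_U` for all `i`. -/
theorem algoU_terminates {V : Type*} [Fintype V]
    (G : SimpleGraph V) (hconn : G.Connected) (r : V) :
    ¬ ∃ e : ℕ → Config V,
        (∀ i, ValidU G r (e i)) ∧ ∀ i, Step r (execU G) (e i) (e (i + 1)) := by
  rintro ⟨e, hvalid, hstep⟩
  have hle : ∀ i p, (e (i + 1)).d p ≠ (e i).d p → ∀ q, G.Adj p q →
      (e (i + 1)).d p ≤ (e i).d q + 1 := fun i p hne q hq => by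
    rw [((hstep i).change hne).1]
    exact Nat.succ_le_succ (Nat.sInf_le ⟨q, hq, rfl⟩)
  have hex : ∀ i p, (e (i + 1)).d p ≠ (e i).d p → ∃ q, G.Adj p q ∧
      (e (i + 1)).d p = (e i).d q + 1 := fun i p hne => by
    obtain ⟨hd, q, hq, hmin⟩ := (hstep i).change hne
    exact ⟨q, hq, by rw [hd, hmin]⟩
  have hbound := le_add_dist_of_change_le G hconn r (fun i => (e i).d) (fun i => (hvalid i).1)
    hle (Finset.univ.sup (e 0).d) fun p => Finset.le_sup (Finset.mem_univ p)
  have hconst : ∀ᶠ i in Filter.atTop, ∀ p, (e (i + 1)).d p = (e i).d p := by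
    refine Filter.eventually_all.2 fun p => ?_
    filter_upwards [(Filter.eventually_all_finite (Set.finite_Iic _)).2 fun v _ =>
      eventually_not_change_to G (fun i => (e i).d) hle hex v p] with i hi
    by_contra hne
    exact hi _ (Set.mem_Iic.2 (hbound (i + 1) p)) ⟨hne, rfl⟩
  obtain ⟨N, hN⟩ := Filter.eventually_atTop.1 hconst
  have hpar := fun i (hi : N ≤ i) => (hstep i).parOk_of_d_eq (funext (hN i hi))
  have hlt : ∀ n, {p | ¬ parOk (e (N + (n + 1))) p}.ncard < {p | ¬ parOk (e (N + n)) p}.ncard := by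
    intro n
    obtain ⟨hmono, p, hbad, hgood⟩ := hpar (N + n) (Nat.le_add_right _ _)
    refine Set.ncard_lt_ncard ⟨?_, fun h => h hbad hgood⟩ (Set.toFinite _)
    exact fun q hq hq' => hq (hmono q hq')
  exact not_strictAnti_of_wellFoundedLT (fun n => {p | ¬ parOk (e (N + n)) p}.ncard)
    (strictAnti_nat_of_succ_lt hlt)
end

section
/- For every k ≥ 1 and every D ≥ 2k+3, there exists a sequence of configurations γ_0 ↦ γ_1 ↦ … ↦ γ_m of Algo_HC(D) on the graph 𝒢_k rooted at R, with m ≥ (2k+2)(2^k − 1), in which every rule executed by any vertex in any step is rule HC2. Hence the stabilization time in steps of Algo_HC(D) is at least (2k+2)(2^k−1) on a graph with 4k+3 vertices and diameter 2k+3, i.e., exponential in the diameter. -/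
open SimpleGraph

/-- The vertices of the graph `𝒢_k`: `R`, `h.0`, `f.0`, and `e.j`, `f.j`, `g.j`, `h.j`
for `1 ≤ j ≤ k` (index `j : Fin k` encodes `j+1`). -/
inductive GVert (k : ℕ) where
  | R : GVert k
  | h0 : GVert k
  | f0 : GVert k
  | e : Fin k → GVert k
  | f : Fin k → GVert k
  | g : Fin k → GVert k
  | h : Fin k → GVert k
  deriving DecidableEq, Fintype

/-- The base edges of `𝒢_k`: `{R,h.0}`, `{h.0,f.0}`, `{f.0,e.1}`, `{e.j,f.j}`,
`{g.j,e.j}`, `{f.j,h.j}` for `1 ≤ j ≤ k`, and `{f.j,e.(j+1)}` for `1 ≤ j ≤ k-1`. -/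
def gbase (k : ℕ) : GVert k → GVert k → Prop
  | .R, .h0 => True
  | .h0, .f0 => True
  | .f0, .e j => (j : ℕ) = 0
  | .e j, .f j' => j = j'
  | .g j, .e j' => j = j'
  | .f j, .h j' => j = j'
  | .f j, .e j' => (j' : ℕ) = (j : ℕ) + 1
  | _, _ => False

/-- The graph `𝒢_k`. -/
def GGraph (k : ℕ) : SimpleGraph (GVert k) := SimpleGraph.fromRel (gbase k)

/-- The vertices of `𝒢_k` are `R`, `h.0`, `f.0` and four families indexed by `Fin k`. -/
def GVert.equivSum (k : ℕ) : GVert k ≃ Fin 3 ⊕ (Fin k ⊕ Fin k) ⊕ (Fin k ⊕ Fin k) where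
  toFun
    | .R => .inl 0
    | .h0 => .inl 1
    | .f0 => .inl 2
    | .e j => .inr (.inl (.inl j))
    | .f j => .inr (.inl (.inr j))
    | .g j => .inr (.inr (.inl j))
    | .h j => .inr (.inr (.inr j))
  invFun
    | .inl 0 => .R
    | .inl 1 => .h0
    | .inl 2 => .f0
    | .inr (.inl (.inl j)) => .e j
    | .inr (.inl (.inr j)) => .f j
    | .inr (.inr (.inl j)) => .g j
    | .inr (.inr (.inr j)) => .h j
  left_inv v := by cases v <;> rfl
  right_inv v := by
    rcases v with i | (j | j) | (j | j)
    · fin_cases i <;> rfl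
    all_goals rfl

lemma card_GVert (k : ℕ) : Fintype.card (GVert k) = 4 * k + 3 := by
  rw [Fintype.card_congr (GVert.equivSum k)]
  simp only [Fintype.card_sum, Fintype.card_fin]
  ring

section Diameter

variable {k : ℕ}

lemma GGraph_adj {u v : GVert k} : (GGraph k).Adj u v ↔ u ≠ v ∧ (gbase k u v ∨ gbase k v u) :=
  SimpleGraph.fromRel_adj _ _ _

/-- The distance from `R` to a vertex of `𝒢_k`. -/
def GVert.depth : GVert k → ℤ
  | .R => 0
  | .h0 => 1
  | .f0 => 2
  | .e j => 2 * j + 3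
  | .f j => 2 * j + 4
  | .g j => 2 * j + 4
  | .h j => 2 * j + 5

/-- The vertices of the path `R, h.0, f.0, e.1, f.1, …, e.k, f.k`, in order. -/
def spine (k n : ℕ) : GVert k :=
  if n = 0 then .R else if n = 1 then .h0 else
  if h : (n - 3) / 2 < k ∧ 3 ≤ n then
    if n % 2 = 1 then .e ⟨(n - 3) / 2, h.1⟩ else .f ⟨(n - 3) / 2, h.1⟩
  else .f0

lemma spine_e (j : Fin k) : spine k (2 * j + 3) = .e j := by
  rw [spine, if_neg (by omega), if_neg (by omega), dif_pos ⟨by omega, by omega⟩,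
    if_pos (by omega)]
  exact congrArg GVert.e (Fin.ext (by dsimp only; omega))

lemma spine_f (j : Fin k) : spine k (2 * j + 4) = .f j := by
  rw [spine, if_neg (by omega), if_neg (by omega), dif_pos ⟨by omega, by omega⟩,
    if_neg (by omega)]
  exact congrArg GVert.f (Fin.ext (by dsimp only; omega))

lemma spine_adj {n : ℕ} (hn : n < 2 * k + 2) :
    (GGraph k).Adj (spine k n) (spine k (n + 1)) := by
  rcases n with _ | _ | _ | n
  · simp [spine, GGraph_adj, gbase]
  · simp [spine, GGraph_adj, gbase]
  · have := spine_e (k := k) ⟨0, by omega⟩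
    simp only [mul_zero, zero_add] at this
    have h₂ : spine k 2 = .f0 := by simp [spine]
    simp only [Nat.reduceAdd, this, h₂]
    simp [GGraph_adj, gbase]
  · obtain ⟨j, rfl | rfl⟩ := Nat.even_or_odd' n
    · have h₁ := spine_e (k := k) ⟨j, by omega⟩
      have h₂ := spine_f (k := k) ⟨j, by omega⟩
      simp only at h₁ h₂
      simp only [Nat.add_assoc, Nat.reduceAdd, h₁, h₂]
      simp [GGraph_adj, gbase]
    · have h₁ := spine_f (k := k) ⟨j, by omega⟩
      have h₂ := spine_e (k := k) ⟨j + 1, by omega⟩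
      simp only [mul_add, mul_one, Nat.add_assoc, Nat.reduceAdd] at h₁ h₂
      simp only [Nat.add_assoc, Nat.reduceAdd, h₁, h₂]
      simp [GGraph_adj, gbase]

lemma edist_spine_add (m n : ℕ) (h : m + n ≤ 2 * k + 2) :
    (GGraph k).edist (spine k m) (spine k (m + n)) ≤ n := by
  induction n with
  | zero => simp
  | succ n ih =>
    calc _ ≤ (GGraph k).edist (spine k m) (spine k (m + n)) +
          (GGraph k).edist (spine k (m + n)) (spine k (m + n + 1)) := SimpleGraph.edist_triangle
      _ ≤ n + 1 := by
          gcongr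
          · exact ih (by omega)
          · exact (SimpleGraph.edist_eq_one_iff_adj.mpr (spine_adj (by omega))).le
      _ = _ := by push_cast; rfl

lemma edist_spine (m n : ℕ) (hm : m ≤ 2 * k + 2) (hn : n ≤ 2 * k + 2) :
    (GGraph k).edist (spine k m) (spine k n) ≤ ((m - n + (n - m) : ℕ) : ℕ∞) := by
  rcases le_total m n with h | h
  · obtain ⟨c, rfl⟩ := Nat.exists_eq_add_of_le h
    have : m - (m + c) + (m + c - m) = c := by omega
    rw [this]
    exact edist_spine_add m c hn
  · obtain ⟨c, rfl⟩ := Nat.exists_eq_add_of_le h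
    have : n + c - n + (n - (n + c)) = c := by omega
    rw [this, SimpleGraph.edist_comm]
    exact edist_spine_add n c hm

/-- Every vertex lies on the spine, or is a leaf attached to the spine beyond `f.0`. -/
lemma exists_spine (v : GVert k) : ∃ a n : ℕ, n ≤ 2 * k + 2 ∧ (a = 0 ∨ a = 1 ∧ 3 ≤ n) ∧
    (GGraph k).edist v (spine k n) ≤ a := by
  rcases v with _ | _ | _ | j | j | j | j
  · exact ⟨0, 0, by omega, by simp, by simp [spine]⟩
  · exact ⟨0, 1, by omega, by simp, by simp [spine]⟩
  · exact ⟨0, 2, by omega, by simp, by simp [spine]⟩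
  · exact ⟨0, 2 * j + 3, by omega, by simp, by simp [spine_e]⟩
  · exact ⟨0, 2 * j + 4, by omega, by simp, by simp [spine_f]⟩
  · refine ⟨1, 2 * j + 3, by omega, by omega, ?_⟩
    rw [spine_e]
    exact (SimpleGraph.edist_eq_one_iff_adj.mpr (by simp [GGraph_adj, gbase])).le
  · refine ⟨1, 2 * j + 4, by omega, by omega, ?_⟩
    rw [spine_f]
    exact (SimpleGraph.edist_eq_one_iff_adj.mpr (by simp [GGraph_adj, gbase])).le

lemma edist_le (u v : GVert k) : (GGraph k).edist u v ≤ ((2 * k + 3 : ℕ) : ℕ∞) := by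
  obtain ⟨a, m, hm, ha, hu⟩ := exists_spine u
  obtain ⟨b, n, hn, hb, hv⟩ := exists_spine v
  rw [SimpleGraph.edist_comm] at hv
  calc (GGraph k).edist u v
      ≤ (GGraph k).edist u (spine k m) + (GGraph k).edist (spine k m) v :=
        SimpleGraph.edist_triangle
    _ ≤ (GGraph k).edist u (spine k m) + ((GGraph k).edist (spine k m) (spine k n) +
          (GGraph k).edist (spine k n) v) := by gcongr; exact SimpleGraph.edist_triangle
    _ ≤ a + (((m - n + (n - m) : ℕ) : ℕ∞) + b) := by gcongr; exact edist_spine m n hm hn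
    _ = ((a + (m - n + (n - m) + b) : ℕ) : ℕ∞) := by push_cast; rfl
    _ ≤ _ := by
      norm_cast
      omega

lemma depth_le_of_adj {u v : GVert k} (h : (GGraph k).Adj u v) : v.depth ≤ u.depth + 1 := by
  rw [GGraph_adj] at h
  rcases u with _ | _ | _ | i | i | i | i <;> rcases v with _ | _ | _ | j | j | j | j <;>
    simp [gbase, GVert.depth, Fin.ext_iff] at h ⊢ <;> omega

lemma depth_le_of_walk {u v : GVert k} (w : (GGraph k).Walk u v) :
    v.depth ≤ u.depth + w.length := by
  induction w with
  | nil => simp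
  | cons h w ih =>
    have := depth_le_of_adj h
    simp only [SimpleGraph.Walk.length_cons]
    push_cast
    omega

lemma GGraph_diam (hk : 1 ≤ k) : (GGraph k).diam = 2 * k + 3 := by
  have hle : (GGraph k).ediam ≤ ((2 * k + 3 : ℕ) : ℕ∞) :=
    SimpleGraph.ediam_le_of_edist_le edist_le
  have hge : ((2 * k + 3 : ℕ) : ℕ∞) ≤ (GGraph k).ediam := by
    refine le_trans ?_ (SimpleGraph.edist_le_ediam (u := .R) (v := .h ⟨k - 1, by omega⟩))
    refine le_iInf fun w => ?_
    have := depth_le_of_walk w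
    simp only [GVert.depth] at this
    norm_cast
    omega
  rw [SimpleGraph.diam, le_antisymm hle hge]
  simp

end Diameter

section Execution

variable {V : Type*} {G : SimpleGraph V}

lemma minD_eq_of_forall_le {γ : Config V} {p q : V} (hq : G.Adj p q)
    (hmin : ∀ w, G.Adj p w → γ.d q ≤ γ.d w) : minD G γ p = γ.d q :=
  le_antisymm (Nat.sInf_le ⟨q, hq, rfl⟩)
    (le_csInf ⟨_, q, hq, rfl⟩ (by rintro _ ⟨w, hw, rfl⟩; exact hmin w hw))

lemma execHC2_of_forall_le {γ γ' : Config V} {p : V} (q : V) (hq : G.Adj p q)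
    (hmin : ∀ w, G.Adj p w → γ.d q ≤ γ.d w) (hpar : γ.d q < γ.d (γ.par p))
    (hd : γ'.d p = γ.d q + 1) (hp : γ'.par p = q) : execHC2 G γ γ' p := by
  have h := minD_eq_of_forall_le hq hmin
  exact ⟨h ▸ hpar, by rw [h, hd], hp ▸ hq, by rw [hp, h]⟩

lemma Step.of_forall {r : V} {exec : Config V → Config V → V → Prop} {γ γ' : Config V} (v : V)
    (hv : v ≠ r ∧ exec γ γ' v)
    (h : ∀ p, (p ≠ r ∧ exec γ γ' p) ∨ (γ'.d p = γ.d p ∧ γ'.par p = γ.par p)) :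
    Step r exec γ γ' :=
  ⟨{p | p ≠ r ∧ exec γ γ' p}, ⟨v, hv⟩, fun _ hp => hp, fun p hp => (h p).resolve_left hp⟩

/-- `HC2Run G r D n γ γ'`: a sequence of `n` steps through valid configurations leads from `γ`
to `γ'`, all executed rules being `HC2`. -/
inductive HC2Run (G : SimpleGraph V) (r : V) (D : ℕ) : ℕ → Config V → Config V → Prop
  | refl {γ : Config V} : ValidB G r D γ → HC2Run G r D 0 γ γ
  | tail {n : ℕ} {γ γ' γ'' : Config V} : HC2Run G r D n γ γ' → Step r (execHC2 G) γ' γ'' →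
      ValidB G r D γ'' → HC2Run G r D (n + 1) γ γ''

lemma HC2Run.trans {r : V} {D m n : ℕ} {γ γ' γ'' : Config V} (h : HC2Run G r D m γ γ')
    (h' : HC2Run G r D n γ' γ'') : HC2Run G r D (m + n) γ γ'' := by
  induction h' with
  | refl _ => exact h
  | tail _ hs hv ih => exact .tail (ih h) hs hv

lemma HC2Run.exists_seq {r : V} {D n : ℕ} {γ γ' : Config V} (h : HC2Run G r D n γ γ') :
    ∃ s : ℕ → Config V, s n = γ' ∧ (∀ i ≤ n, ValidB G r D (s i)) ∧
      ∀ i < n, Step r (execHC2 G) (s i) (s (i + 1)) := by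
  induction h with
  | @refl γ hv => exact ⟨fun _ => γ, rfl, fun _ _ => hv, by simp⟩
  | @tail n γ γ' γ'' _ hs hv ih =>
    obtain ⟨s, hn, hval, hstep⟩ := ih
    refine ⟨fun i => if i ≤ n then s i else γ'', by simp, fun i _ => ?_, fun i hi => ?_⟩
    · dsimp only
      split_ifs with h
      · exact hval i h
      · exact hv
    · rcases (Nat.lt_succ_iff.mp hi).lt_or_eq with h | rfl
      · simpa [h.le, Nat.succ_le_of_lt h] using hstep i h
      · simpa [hn] using hs

end Execution

section Construction

variable {k : ℕ}

/-- The configurations of the long execution. The values of the vertices `e.j` and `f.j` are given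
by `x` and `y`; those of `h.0`, `g.j` and `h.j` are frozen at `2k+2`. A vertex `e.j` or `f.j` of
value `2k+3` is attached to its pendant neighbor; the other vertices `e.j` and `f.j` have parents
`p j` and `e.j`. -/
def lineConfig (x y : Fin k → ℕ) (p : Fin k → GVert k) : Config (GVert k) where
  d
    | .R => 0
    | .h0 => 2 * k + 2
    | .f0 => 2 * k + 3
    | .e j => x j
    | .f j => y j
    | .g _ => 2 * k + 2
    | .h _ => 2 * k + 2
  par
    | .R => .R
    | .h0 => .R
    | .f0 => .h0
    | .e j => if x j = 2 * k + 3 then .g j else p j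
    | .f j => if y j = 2 * k + 3 then .h j else .e j
    | .g j => .e j
    | .h j => .f j

/-- `p j` is one of the neighbors of `e.j` on the spine of `𝒢_k`. -/
def SpineParents (p : Fin k → GVert k) : Prop :=
  ∀ j, (GGraph k).Adj (.e j) (p j) ∧ p j ≠ .g j

lemma validB_lineConfig {D : ℕ} (hD : 2 * k + 3 ≤ D) {x y : Fin k → ℕ} {p : Fin k → GVert k}
    (hx : ∀ j, 1 ≤ x j ∧ x j ≤ 2 * k + 3) (hy : ∀ j, 1 ≤ y j ∧ y j ≤ 2 * k + 3)
    (hp : SpineParents p) : ValidB (GGraph k) GVert.R D (lineConfig x y p) := by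
  refine ⟨rfl, fun v hv => ⟨?_, ?_⟩⟩
  · rcases v with _ | _ | _ | j | j | j | j <;> simp only [lineConfig]
    · exact absurd rfl hv
    · simp [GGraph_adj, gbase]
    · simp [GGraph_adj, gbase]
    · split_ifs
      · simp [GGraph_adj, gbase]
      · exact (hp j).1
    · split_ifs <;> simp [GGraph_adj, gbase]
    · simp [GGraph_adj, gbase]
    · simp [GGraph_adj, gbase]
  · rcases v with _ | _ | _ | j | j | j | j <;> simp only [lineConfig]
    · exact absurd rfl hv
    · omega
    · omega
    · have := hx j; omega
    · have := hy j; omega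
    · omega
    · omega

/-- The value of `e.j` moves to `f.j`, increasing by one, while `e.j` attaches to `g.j`. -/
lemma step_e_to_f {x : Fin k → ℕ} {p : Fin k → GVert k} (hp : SpineParents p) (j : Fin k)
    (hj : x j + 2 ≤ 2 * k + 3) (hgt : ∀ i, j < i → x i = 2 * k + 3) :
    Step GVert.R (execHC2 (GGraph k)) (lineConfig x (fun _ => 2 * k + 3) p)
      (lineConfig (Function.update x j (2 * k + 3))
        (Function.update (fun _ => 2 * k + 3) j (x j + 1)) p) := by
  have he : execHC2 (GGraph k) (lineConfig x (fun _ => 2 * k + 3) p)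
      (lineConfig (Function.update x j (2 * k + 3))
        (Function.update (fun _ => 2 * k + 3) j (x j + 1)) p) (.e j) := by
    refine execHC2_of_forall_le (.g j) (by simp [GGraph_adj, gbase]) ?_ ?_
      (by simp [lineConfig]) (by simp [lineConfig])
    · rintro (_ | _ | _ | i | i | i | i) hi <;> simp [GGraph_adj, gbase, lineConfig] at hi ⊢
    · have hpj := hp j
      rw [GGraph_adj] at hpj
      have hne : x j ≠ 2 * k + 3 := by omega
      rcases h : p j with _ | _ | _ | i | i | i | i <;>
        simp_all [gbase, lineConfig]
  have hf : execHC2 (GGraph k) (lineConfig x (fun _ => 2 * k + 3) p)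
      (lineConfig (Function.update x j (2 * k + 3))
        (Function.update (fun _ => 2 * k + 3) j (x j + 1)) p) (.f j) := by
    refine execHC2_of_forall_le (.e j) (by simp [GGraph_adj, gbase]) ?_ ?_
      (by simp [lineConfig]) ?_
    · rintro (_ | _ | _ | i | i | i | i) hi <;> simp [GGraph_adj, gbase, lineConfig] at hi ⊢
      · rcases hi with hi | rfl
        · rw [hgt i (by rw [Fin.lt_def]; omega)]; omega
        · rfl
      · omega
    · simp [lineConfig]; omega
    · simp [lineConfig]; omega
  refine Step.of_forall (.e j) ⟨by simp, he⟩ ?_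
  rintro (_ | _ | _ | i | i | i | i)
  case e | f =>
    by_cases hij : i = j
    · subst hij; left; exact ⟨by simp, by assumption⟩
    · right; simp [lineConfig, hij]
  all_goals right; simp [lineConfig]

/-- The value of `f.j` moves to both `e.j` and `e.(j+1)`, increasing by one, while `f.j` attaches
to `h.j`. -/
lemma step_f_to_e {x : Fin k → ℕ} {p : Fin k → GVert k} (j : Fin k) {v : ℕ}
    (hv : v + 2 ≤ 2 * k + 3) (hgt : ∀ i, j < i → x i = 2 * k + 3) :
    Step GVert.R (execHC2 (GGraph k))
      (lineConfig (Function.update x j (2 * k + 3))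
        (Function.update (fun _ => 2 * k + 3) j (v + 1)) p)
      (lineConfig (fun i => if i = j ∨ (i : ℕ) = j + 1 then v + 2 else x i) (fun _ => 2 * k + 3)
        (fun i => if i = j ∨ (i : ℕ) = j + 1 then .f j else p i)) := by
  have hx : ∀ i : Fin k, i = j ∨ (i : ℕ) = j + 1 →
      Function.update x j (2 * k + 3) i = 2 * k + 3 := by
    rintro i (rfl | hi)
    · simp
    · have hlt : j < i := by rw [Fin.lt_def]; omega
      rw [Function.update_of_ne hlt.ne', hgt i hlt]
  have hf : execHC2 (GGraph k)
      (lineConfig (Function.update x j (2 * k + 3))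
        (Function.update (fun _ => 2 * k + 3) j (v + 1)) p)
      (lineConfig (fun i => if i = j ∨ (i : ℕ) = j + 1 then v + 2 else x i) (fun _ => 2 * k + 3)
        (fun i => if i = j ∨ (i : ℕ) = j + 1 then .f j else p i)) (.f j) := by
    refine execHC2_of_forall_le (.h j) (by simp [GGraph_adj, gbase]) ?_ ?_
      (by simp [lineConfig]) (by simp [lineConfig])
    · rintro (_ | _ | _ | i | i | i | i) hi <;> simp [GGraph_adj, gbase, lineConfig] at hi ⊢
      rw [hx i hi.symm]; omega
    · have : v ≠ 2 * k + 2 := by omega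
      simp [lineConfig, this]
  refine Step.of_forall (.f j) ⟨by simp, hf⟩ ?_
  rintro (_ | _ | _ | i | i | i | i)
  case e =>
    by_cases hi : i = j ∨ (i : ℕ) = j + 1
    · by_cases hv' : v + 2 = 2 * k + 3
      · right
        have hxi := hx i hi
        simp only [lineConfig, hi, hxi, hv', if_true, and_self]
      · left
        refine ⟨by simp, execHC2_of_forall_le (.f j) ?_ ?_ ?_ ?_ ?_⟩
        · simpa [GGraph_adj, gbase, Fin.ext_iff] using hi
        · rintro (_ | _ | _ | l | l | l | l) hl <;>
            simp [GGraph_adj, gbase, lineConfig] at hl ⊢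
          · omega
          · by_cases hlj : l = j
            · simp [hlj]
            · rw [Function.update_of_ne hlj]; omega
          · omega
        · simp [lineConfig, hx i hi]; omega
        · simp [lineConfig, hi]
        · simp only [lineConfig, hi, hv', if_true, if_false]
    · right
      have hij : i ≠ j := fun h => hi (.inl h)
      simp only [lineConfig, hi, Function.update_of_ne hij, if_false, and_self]
  case f =>
    by_cases hij : i = j
    · subst hij; left; exact ⟨by simp, hf⟩
    · right; simp [lineConfig, hij]
  all_goals right; simp [lineConfig]

/-- The number of rounds of the execution started by one token at the `r`-th last vertex `e.j`. -/
def tokenCount (r L : ℕ) : ℕ := ∑ m ∈ Finset.range (r + 1), L.choose m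

lemma tokenCount_zero_left (L : ℕ) : tokenCount 0 L = 1 := by simp [tokenCount]

lemma tokenCount_zero_right (r : ℕ) : tokenCount r 0 = 1 := by
  simp [tokenCount, Finset.sum_range_succ']

lemma tokenCount_succ_succ (r L : ℕ) :
    tokenCount (r + 1) (L + 1) = tokenCount r L + tokenCount (r + 1) L := by
  rw [tokenCount, Finset.sum_range_succ', tokenCount, tokenCount, Finset.sum_range_succ' _ (r + 1)]
  simp only [Nat.choose_succ_succ, Finset.sum_add_distrib, Nat.choose_zero_right]
  ring

lemma sum_tokenCount_succ (q L : ℕ) : ∑ r ∈ Finset.range (q + 1), tokenCount r (L + 1) =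
    ∑ r ∈ Finset.range q, tokenCount r L + ∑ r ∈ Finset.range (q + 1), tokenCount r L := by
  rw [Finset.sum_range_succ', Finset.sum_range_succ' _ q]
  simp only [tokenCount_succ_succ, Finset.sum_add_distrib, tokenCount_zero_left]
  ring

lemma two_mul_sum_tokenCount (L : ℕ) :
    2 * ∑ r ∈ Finset.range L, tokenCount r L = L * 2 ^ L := by
  induction L with
  | zero => simp
  | succ L ih =>
    have h : tokenCount L L = 2 ^ L := Nat.sum_range_choose L
    rw [sum_tokenCount_succ, Finset.sum_range_succ, h, pow_succ]
    linarith

/-- A value `2k+3-2L` at `e.j` can be used to run through `2 (tokenCount (k-j) L - 1)` steps,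
after which `e.j` has value `2k+3`. -/
lemma exists_run_token {D : ℕ} (hD : 2 * k + 3 ≤ D) (L : ℕ) :
    ∀ (j : Fin k) (x : Fin k → ℕ) (p : Fin k → GVert k), SpineParents p →
      (∀ i, 1 ≤ x i ∧ x i ≤ 2 * k + 3) → x j + 2 * L = 2 * k + 3 →
      (∀ i, j < i → x i = 2 * k + 3) →
      ∃ (n : ℕ) (p' : Fin k → GVert k), n + 2 = 2 * tokenCount (k - j) L ∧ SpineParents p' ∧
        HC2Run (GGraph k) GVert.R D n (lineConfig x (fun _ => 2 * k + 3) p)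
          (lineConfig (Function.update x j (2 * k + 3)) (fun _ => 2 * k + 3) p') := by
  induction L with
  | zero =>
    intro j x p hp hx hj _
    refine ⟨0, p, by simp [tokenCount_zero_right], hp, ?_⟩
    rw [Function.update_eq_self_iff.mpr (by omega)]
    exact .refl (validB_lineConfig hD hx (fun _ => by omega) hp)
  | succ L ih =>
    intro j x p hp hx hj hgt
    have hxj := hx j
    set x₂ : Fin k → ℕ := fun i => if i = j ∨ (i : ℕ) = j + 1 then x j + 2 else x i with hx₂
    set p₂ : Fin k → GVert k := fun i => if i = j ∨ (i : ℕ) = j + 1 then .f j else p i with hp₂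
    have hval₂ : ∀ i, 1 ≤ x₂ i ∧ x₂ i ≤ 2 * k + 3 := by
      intro i
      have := hx i
      simp only [hx₂]
      split_ifs <;> omega
    have hsp₂ : SpineParents p₂ := by
      intro i
      simp only [hp₂]
      split_ifs with h
      · simpa [GGraph_adj, gbase, Fin.ext_iff] using h
      · exact hp i
    have hrun : HC2Run (GGraph k) GVert.R D 2 (lineConfig x (fun _ => 2 * k + 3) p)
        (lineConfig x₂ (fun _ => 2 * k + 3) p₂) := by
      refine .tail (.tail (.refl (validB_lineConfig hD hx (fun _ => by omega) hp))
        (step_e_to_f hp j (by omega) hgt) (validB_lineConfig hD ?_ ?_ hp))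
        (step_f_to_e j (by omega) hgt) (validB_lineConfig hD hval₂ (fun _ => by omega) hsp₂)
      · intro i
        have := hx i
        rw [Function.update_apply]
        split_ifs <;> omega
      · intro i
        rw [Function.update_apply]
        split_ifs <;> omega
    obtain ⟨r, hr⟩ : ∃ r, k - (j : ℕ) = r + 1 := ⟨k - j - 1, by omega⟩
    obtain ⟨n, p₃, hn, hsp₃, hrun₃⟩ : ∃ (n : ℕ) (p' : Fin k → GVert k),
        n + 2 = 2 * tokenCount r L ∧ SpineParents p' ∧
        HC2Run (GGraph k) GVert.R D n (lineConfig x₂ (fun _ => 2 * k + 3) p₂)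
          (lineConfig (Function.update x j (x j + 2)) (fun _ => 2 * k + 3) p') := by
      by_cases hjk : (j : ℕ) + 1 < k
      · obtain ⟨n, p', hn, hsp', hrun'⟩ := ih ⟨j + 1, hjk⟩ x₂ p₂ hsp₂ hval₂
          (by simp [hx₂]; omega) fun i hi => by
            rw [Fin.lt_def] at hi
            dsimp only at hi
            have h : ¬(i = j ∨ (i : ℕ) = j + 1) := by rw [Fin.ext_iff]; omega
            simp only [hx₂, h, if_false]
            exact hgt i (by rw [Fin.lt_def]; omega)
        refine ⟨n, p', by rw [hn]; congr 2; dsimp only; omega, hsp', ?_⟩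
        convert hrun' using 2
        funext i
        simp only [hx₂, Function.update_apply, Fin.ext_iff]
        split_ifs <;> first | omega | (apply hgt; rw [Fin.lt_def]; omega)
      · obtain rfl : r = 0 := by omega
        refine ⟨0, p₂, by rw [tokenCount_zero_left], hsp₂, ?_⟩
        have : Function.update x j (x j + 2) = x₂ := by
          funext i
          have hi : (i : ℕ) ≠ j + 1 := by omega
          simp [hx₂, Function.update_apply, hi]
        rw [this]
        exact .refl (validB_lineConfig hD hval₂ (fun _ => by omega) hsp₂)
    obtain ⟨m, p₄, hm, hsp₄, hrun₄⟩ := ih j (Function.update x j (x j + 2)) p₃ hsp₃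
      (fun i => by
        have := hx i
        rw [Function.update_apply]
        split_ifs <;> omega)
      (by rw [Function.update_self]; omega)
      (fun i hi => by rw [Function.update_of_ne hi.ne', hgt i hi])
    refine ⟨2 + n + m, p₄, ?_, hsp₄, ?_⟩
    · rw [hr] at hm ⊢
      rw [tokenCount_succ_succ]
      omega
    · rw [Function.update_idem] at hrun₄
      exact (hrun.trans hrun₃).trans hrun₄

/-- Starting with value `1` at every `e.j`, the values of the last `r` vertices `e.j` are used up
one after the other. -/
lemma exists_run_tokens {D : ℕ} (hD : 2 * k + 3 ≤ D) (r : ℕ) (hr : r ≤ k) :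
    ∃ (n : ℕ) (p : Fin k → GVert k),
      n + 2 * (r + 1) = 2 * ∑ q ∈ Finset.range (r + 1), tokenCount q (k + 1) ∧ SpineParents p ∧
      HC2Run (GGraph k) GVert.R D n
        (lineConfig (fun _ => 1) (fun _ => 2 * k + 3) GVert.f)
        (lineConfig (fun i => if (i : ℕ) + r < k then 1 else 2 * k + 3)
          (fun _ => 2 * k + 3) p) := by
  induction r with
  | zero =>
    have hsp : SpineParents (k := k) GVert.f := fun j => by simp [GGraph_adj, gbase]
    refine ⟨0, GVert.f, by simp [tokenCount_zero_left], hsp, ?_⟩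
    simp only [add_zero, Fin.is_lt, if_true]
    exact .refl (validB_lineConfig hD (fun _ => by omega) (fun _ => by omega) hsp)
  | succ r ih =>
    obtain ⟨n, p, hn, hsp, hrun⟩ := ih (by omega)
    obtain ⟨m, p', hm, hsp', hrun'⟩ := exists_run_token hD (k + 1) ⟨k - (r + 1), by omega⟩
      (fun i => if (i : ℕ) + r < k then 1 else 2 * k + 3) p hsp
      (fun i => by split_ifs <;> omega)
      (by dsimp only; rw [if_pos (by omega)]; omega)
      (fun i hi => by
        rw [Fin.lt_def] at hi
        dsimp only at hi ⊢
        rw [if_neg (by omega)])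
    refine ⟨n + m, p', ?_, hsp', ?_⟩
    · have h : k - (k - (r + 1)) = r + 1 := by omega
      dsimp only at hm
      rw [h] at hm
      rw [Finset.sum_range_succ]
      omega
    · convert hrun.trans hrun' using 2
      funext i
      simp only [Function.update_apply, Fin.ext_iff]
      split_ifs <;> omega

end Construction

/-- For every `k ≥ 1` and every `D ≥ 2k+3`, the graph `𝒢_k` has `4k+3` vertices and
diameter `2k+3`, and there is a sequence of configurations `γ_0 ↦ … ↦ γ_m` of
`Algo_HC(D)` on `𝒢_k` rooted at `R`, with `m ≥ (2k+2)(2^k − 1)`, in which every rule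
executed by any vertex in any step is rule `HC2`. Hence the stabilization time in
steps of `Algo_HC(D)` is at least `(2k+2)(2^k − 1)` on a graph with `4k+3` vertices
and diameter `2k+3`, i.e., exponential in the diameter. -/
theorem algoHC_steps_exponential (k D : ℕ) (hk : 1 ≤ k) (hD : 2 * k + 3 ≤ D) :
    Fintype.card (GVert k) = 4 * k + 3 ∧
    (GGraph k).diam = 2 * k + 3 ∧
    ∃ (m : ℕ) (γ : ℕ → Config (GVert k)),
      (2 * k + 2) * (2 ^ k - 1) ≤ m ∧
      (∀ i ≤ m, ValidB (GGraph k) GVert.R D (γ i)) ∧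
      (∀ i < m, Step GVert.R (execHC2 (GGraph k)) (γ i) (γ (i + 1))) := by
  obtain ⟨n, p, hn, -, hrun⟩ := exists_run_tokens hD k le_rfl
  obtain ⟨s, -, hvalid, hstep⟩ := hrun.exists_seq
  refine ⟨card_GVert k, GGraph_diam hk, n, s, ?_, hvalid, hstep⟩
  rw [two_mul_sum_tokenCount, pow_succ] at hn
  have := Nat.one_le_two_pow (n := k)
  zify [this] at hn ⊢
  linarith
end

section
/- Let D ≥ 𝒟 and let γ be a configuration (with non-root values d_p ∈ {1,…,D}). If γ is a terminal configuration of Algo_B(D), then γ is a terminal configuration of Algo_HC(D). -/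
open SimpleGraph

/-- Let `D ≥ 𝒟`. If `γ` is a terminal configuration of `Algo_B(D)`, then `γ` is a
terminal configuration of `Algo_HC(D)`. -/
theorem terminalB_is_terminalHC {V : Type*} [Fintype V]
    (G : SimpleGraph V) (hconn : G.Connected) (r : V) (D : ℕ) (hD : G.diam ≤ D)
    (γ : Config V) (hvalid : ValidB G r D γ) (hterm : TerminalB G r D γ) :
    TerminalHC G r D γ := by
  intro p hp
  obtain ⟨hadj, -, -⟩ := hvalid.2 p hp
  have hmin : minD G γ p ≤ γ.d (γ.par p) := Nat.sInf_le ⟨γ.par p, hadj, rfl⟩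
  have hpar : γ.d (γ.par p) ≤ D := by
    by_cases h : γ.par p = r
    · rw [h, hvalid.1]
      exact Nat.zero_le D
    · exact (hvalid.2 _ h).2.2
  rcases (hmin.trans hpar).lt_or_eq with hlt | heq
  · obtain ⟨hd, hparOk⟩ := (hterm p hp).1 hlt
    exact ⟨Or.inl hparOk, (Nat.succ.inj (hparOk.symm.trans hd)).le⟩
  · exact ⟨Or.inr (heq ▸ hmin), heq.symm ▸ hpar⟩
end

section
/- Let D ≥ 𝒟. In any terminal configuration of Algo_HC(D), every vertex p satisfies d_p ≤ dist(p, r). -/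
open SimpleGraph

/-- Let `D ≥ 𝒟`. In any terminal configuration of `Algo_HC(D)`, every vertex `p`
satisfies `d p ≤ dist(p, r)`. -/
theorem terminalHC_d_le_dist {V : Type*} [Fintype V]
    (G : SimpleGraph V) (hconn : G.Connected) (r : V) (D : ℕ) (hD : G.diam ≤ D)
    (γ : Config V) (hvalid : ValidB G r D γ) (hterm : TerminalHC G r D γ) :
    ∀ p, γ.d p ≤ G.dist p r := by
  have : Nonempty V := ⟨r⟩
  have hdist (p : V) : G.dist p r ≤ D :=
    (dist_le_diam (connected_iff_ediam_ne_top.mp hconn)).trans hD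
  intro p
  induction hn : G.dist p r generalizing p with
  | zero => simp [hconn.dist_eq_zero_iff.mp hn, hvalid.1]
  | succ n ih =>
    have hpr : p ≠ r := by
      rintro rfl
      simp at hn
    obtain ⟨w, hw⟩ := hconn.exists_walk_length_eq_dist p r
    cases w with
    | nil => exact absurd rfl hpr
    | @cons _ q _ hpq w =>
      have hq : G.dist q r = n := by
        have hle := dist_le w
        have htri := hconn.dist_triangle (u := p) (v := q) (w := r)
        rw [dist_eq_one_iff_adj.mpr hpq] at htri
        rw [Walk.length_cons] at hw
        omega
      have hmin : minD G γ p ≤ γ.d q := Nat.sInf_le ⟨q, hpq, rfl⟩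
      have hdq := ih q hq
      have hD' := hdist p
      obtain ⟨hpar, hle⟩ := hterm p hpr
      unfold parOk at hpar
      omega
end

section
/- If γ ↦ γ' is a step of Algo_FHC(D) in which every vertex that executes a rule executes rule HC2, then γ ↦ γ' is also a possible step of Algo_B(D). -/
open SimpleGraph

/-- If `γ ↦ γ'` is a step of `Algo_FHC(D)` in which every vertex that executes a rule
executes rule `HC2`, then `γ ↦ γ'` is also a possible step of `Algo_B(D)`. -/
theorem stepHC2_is_stepB {V : Type*} [Fintype V]
    (G : SimpleGraph V) (hconn : G.Connected) (r : V) (D : ℕ)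
    (γ γ' : Config V) (hvalid : ValidB G r D γ)
    (hstep : Step r (execHC2 G) γ γ') :
    Step r (execB G D) γ γ' := by
  obtain ⟨S, hne, hS, hout⟩ := hstep
  refine ⟨S, hne, fun p hp => ?_, hout⟩
  obtain ⟨hpr, hlt, hd, hadj, hmin⟩ := hS p hp
  have hparr : γ.par p ≠ r := fun h => by
    rw [h, hvalid.1] at hlt
    exact Nat.not_lt_zero _ hlt
  have hD : minD G γ p < D := hlt.trans_le (hvalid.2 _ hparr).2.2
  refine ⟨hpr, ?_⟩
  by_cases hok : dOk G γ p
  · have hpar : ¬ parOk γ p := fun h => by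
      unfold dOk at hok
      unfold parOk at h
      omega
    exact Or.inr (Or.inl ⟨hD, hok, hpar, hd.trans hok.symm, hadj, hmin⟩)
  · exact Or.inl ⟨hD, hok, hd, hadj, hmin⟩
end
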